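/- In the reduction from Shortest Common Supersequence to String Aligning, let S be a nonempty family of strings over C and let P be any alignment of S_SAP (the family S together with the string s_n of k copies of c_n). Then every column of P whose column set contains a character other than null has column-set diameter at least 1; consequently the number of columns of P containing a non-null character is at most size(P). -/

import Mathlib

/-- The character type of the reduction: ordinary characters `C` together with two
further distinct symbols `cn` and `null`. -/
inductive SapChar (C : Type*) : Type _ where
  | chr : C → SapChar C
  | cn : SapChar C
  | null : SapChar C
  deriving DecidableEq

/-- The distance of the reduction: `d a b = 0` if `a = b`; `1` if `a ≠ b` and
`null ∈ {a, b}`; `1` if `a ≠ b`, `null ∉ {a, b}` and `cn ∈ {a, b}`; `2` otherwise. -/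
def sapDist {C : Type*} [DecidableEq C] (a b : SapChar C) : ℝ :=
  if a = b then 0
  else if a = SapChar.null ∨ b = SapChar.null then 1
  else if a = SapChar.cn ∨ b = SapChar.cn then 1
  else 2

/-- `sapDist` is a metric on `SapChar C`. -/
noncomputable instance {C : Type*} [DecidableEq C] : MetricSpace (SapChar C) where
  dist := sapDist
  dist_self a := by simp [sapDist]
  dist_comm a b := by
    show sapDist a b = sapDist b a
    unfold sapDist
    split_ifs <;> simp_all [eq_comm, or_comm]
  dist_triangle a b c := by
    show sapDist a c ≤ sapDist a b + sapDist b c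
    unfold sapDist
    split_ifs <;> subst_vars <;> simp_all <;> norm_num
  eq_of_dist_eq_zero := by
    intro a b h
    replace h : sapDist a b = 0 := h
    unfold sapDist at h
    split_ifs at h <;> first | assumption | norm_num at h

/-- The size of a paradigm `P : I → Fin m → α`: the sum over columns of the metric
diameter of the column set `P[i] = {P t i : t ∈ I}`. -/
noncomputable def psize {α : Type*} [PseudoMetricSpace α] {I : Type*} {m : ℕ}
    (P : I → Fin m → α) : ℝ :=
  ∑ i : Fin m, Metric.diam (Set.range fun t => P t i)

/-- `P` is an alignment of the family of strings `S`: for each index `t` there is a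
strictly monotone map `f` of the positions of `S t` into the columns of `P` such that
row `t` of `P` agrees with `S t` along `f` and is `null` on all other columns. -/
def IsAlignment {α : Type*} (null : α) {I : Type*} {m : ℕ}
    (S : I → List α) (P : I → Fin m → α) : Prop :=
  ∀ t, ∃ f : Fin (S t).length → Fin m, StrictMono f ∧
    (∀ i, P t (f i) = (S t).get i) ∧
    ∀ j, j ∉ Set.range f → P t j = null

/-- The family `S_SAP`: the strings of `S` (over the ordinary characters) together with
the string consisting of `k` copies of `cn`. -/
def sapFamily {C : Type*} {I : Type*} (S : I → List C) (k : ℕ) :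
    Option I → List (SapChar C) :=
  fun o => o.elim (List.replicate k SapChar.cn) (fun t => (S t).map SapChar.chr)

theorem one_le_sapDist {C : Type*} [DecidableEq C] {a b : SapChar C} (h : a ≠ b) :
    1 ≤ dist a b := by
  change 1 ≤ sapDist a b
  rw [sapDist, if_neg h]
  split_ifs <;> norm_num

/-- Every entry of an alignment is either `null` or a character of the string in that row. -/
theorem IsAlignment.eq_null_or_mem {α : Type*} {null : α} {I : Type*} {m : ℕ}
    {S : I → List α} {P : I → Fin m → α} (hP : IsAlignment null S P) (t : I) (j : Fin m) :
    P t j = null ∨ P t j ∈ S t := by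
  obtain ⟨f, -, hf, hnull⟩ := hP t
  by_cases hj : j ∈ Set.range f
  · obtain ⟨i, rfl⟩ := hj
    exact Or.inr (hf i ▸ List.get_mem _ _)
  · exact Or.inl (hnull j hj)

/-- In an alignment of `sapFamily S k`, the row of the copies of `cn` shares no non-`null`
character with any other row. -/
theorem IsAlignment.eq_null_of_sap_rows_eq {C : Type*} {I : Type*} {S : I → List C} {k m : ℕ}
    {P : Option I → Fin m → SapChar C} (hP : IsAlignment SapChar.null (sapFamily S k) P)
    {t : I} {j : Fin m} (h : P (some t) j = P none j) : P none j = SapChar.null := by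
  rcases hP.eq_null_or_mem none j with h₀ | h₀
  · exact h₀
  rcases hP.eq_null_or_mem (some t) j with h₁ | h₁
  · exact h ▸ h₁
  · obtain ⟨c, -, hc⟩ := List.mem_map.1 h₁
    have hcn : P none j = SapChar.cn := List.eq_of_mem_replicate h₀
    rw [h, hcn] at hc
    cases hc

theorem IsAlignment.one_le_diam_sap_column {C : Type*} [DecidableEq C] {I : Type*} [Finite I]
    [Nonempty I] {S : I → List C} {k m : ℕ} {P : Option I → Fin m → SapChar C}
    (hP : IsAlignment SapChar.null (sapFamily S k) P) {j : Fin m}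
    (hj : ∃ t, P t j ≠ SapChar.null) : 1 ≤ Metric.diam (Set.range fun t => P t j) := by
  obtain ⟨t, ht⟩ : ∃ t, P t j ≠ P none j := by
    by_contra! h
    obtain ⟨t, ht⟩ := hj
    exact ht ((h t).trans (hP.eq_null_of_sap_rows_eq (h (some (Classical.arbitrary I)))))
  exact (one_le_sapDist ht).trans
    (Metric.dist_le_diam_of_mem (Set.finite_range _).isBounded ⟨t, rfl⟩ ⟨none, rfl⟩)

open Classical in
/-- In the reduction from SCS to String Aligning, let `S` be a
nonempty family of strings over `C` and let `P` be any alignment of `S_SAP` (the family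
`S` together with the string of `k` copies of `cn`).  Then every column of `P` whose
column set contains a character other than `null` has column-set diameter at least `1`;
consequently the number of columns of `P` containing a non-`null` character is at most
`size P`. -/
theorem sap_nonnull_columns {C : Type*} [DecidableEq C] {I : Type*}
    [Fintype I] [Nonempty I] (S : I → List C) (k : ℕ)
    {m : ℕ} (P : Option I → Fin m → SapChar C)
    (hP : IsAlignment SapChar.null (sapFamily S k) P) :
    (∀ i : Fin m, (∃ a ∈ Set.range fun t => P t i, a ≠ SapChar.null) →
      1 ≤ Metric.diam (Set.range fun t => P t i)) ∧
    ((Finset.univ.filter fun i : Fin m => ∃ t, P t i ≠ SapChar.null).card : ℝ)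
      ≤ psize P := by
  refine ⟨fun i => ?_, ?_⟩
  · rintro ⟨_, ⟨t, rfl⟩, ht⟩
    exact hP.one_le_diam_sap_column ⟨t, ht⟩
  · rw [Finset.card_eq_sum_ones, Nat.cast_sum, psize, Finset.sum_filter]
    refine Finset.sum_le_sum fun i _ => ?_
    split_ifs with h
    · simpa using hP.one_le_diam_sap_column h
    · exact Metric.diam_nonneg
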